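/- If a sequent Γ ⇒ Δ is provable in the non-well-founded sequent calculus Go_∞, then for any finite sets of formulas Λ₁, Λ₂, Ω with Λ₂ ⊆ Λ₁, the sequent □(Λ₁*), Λ₂*, ⊠Ω, Γ ⇒ Δ is derivable in Go_Seq, where for a finite set of formulas Λ, Λ* denotes the set {A→□A : A ∈ Λ}. -/

import Mathlib

inductive Formula : Type
  | atom : ℕ → Formula
  | bot  : Formula
  | imp  : Formula → Formula → Formula
  | box  : Formula → Formula
deriving DecidableEq

def boxtimes (Γ : Multiset Formula) : Multiset Formula := Γ + Γ.map Formula.box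

inductive GoSeq : Bool → Multiset Formula → Multiset Formula → Prop
  | ax (c) (Γ Δ : Multiset Formula) (A : Formula) : GoSeq c (A ::ₘ Γ) (A ::ₘ Δ)
  | axBot (c) (Γ Δ : Multiset Formula) : GoSeq c (Formula.bot ::ₘ Γ) Δ
  | impL (c) (Γ Δ : Multiset Formula) (A B : Formula) :
      GoSeq c (B ::ₘ Γ) Δ → GoSeq c Γ (A ::ₘ Δ) → GoSeq c ((A.imp B) ::ₘ Γ) Δ
  | impR (c) (Γ Δ : Multiset Formula) (A B : Formula) :
      GoSeq c (A ::ₘ Γ) (B ::ₘ Δ) → GoSeq c Γ ((A.imp B) ::ₘ Δ)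
  | boxGo (c) (Γ Δ Θ : Multiset Formula) (A : Formula) :
      GoSeq c ((Formula.box (A.imp (Formula.box A))) ::ₘ boxtimes Θ) {A} →
      GoSeq c (Γ + Θ.map Formula.box) ((Formula.box A) ::ₘ Δ)
  | cut (Γ Δ : Multiset Formula) (A : Formula) :
      GoSeq true Γ (A ::ₘ Δ) → GoSeq true (A ::ₘ Γ) Δ → GoSeq true Γ Δ

inductive Frag : Bool → ℕ → Multiset Formula → Multiset Formula → Type
  | hole (c) (Γ Δ : Multiset Formula) : Frag c 0 Γ Δ
  | axP (c) (n) (Γ Δ : Multiset Formula) (p : ℕ) :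
      Frag c (n+1) (Formula.atom p ::ₘ Γ) (Formula.atom p ::ₘ Δ)
  | axBot (c) (n) (Γ Δ : Multiset Formula) : Frag c (n+1) (Formula.bot ::ₘ Γ) Δ
  | impL (c) (n) (Γ Δ : Multiset Formula) (A B : Formula) :
      Frag c (n+1) (B ::ₘ Γ) Δ → Frag c (n+1) Γ (A ::ₘ Δ) →
      Frag c (n+1) ((A.imp B) ::ₘ Γ) Δ
  | impR (c) (n) (Γ Δ : Multiset Formula) (A B : Formula) :
      Frag c (n+1) (A ::ₘ Γ) (B ::ₘ Δ) → Frag c (n+1) Γ ((A.imp B) ::ₘ Δ)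
  | box (c) (n) (Γ Δ Θ : Multiset Formula) (l : List Formula) (h : l ≠ []) :
      Frag c (n+1) (boxtimes Θ) (boxtimes (↑l)) →
      ((i : Fin l.length) → Frag c n (boxtimes Θ) {l.get i}) →
      Frag c (n+1) (Γ + Θ.map Formula.box) ((↑(l.map Formula.box) : Multiset Formula) + Δ)
  | cut (n) (Γ Δ : Multiset Formula) (A : Formula) :
      Frag true (n+1) Γ (A ::ₘ Δ) → Frag true (n+1) (A ::ₘ Γ) Δ → Frag true (n+1) Γ Δ

def Frag.trunc : ∀ {c : Bool} {n : ℕ} {Γ Δ : Multiset Formula}, Frag c (n+1) Γ Δ → Frag c n Γ Δ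
  | c, 0, Γ, Δ, _ => .hole c Γ Δ
  | c, n+1, _, _, .axP _ _ Γ Δ p => .axP c n Γ Δ p
  | c, n+1, _, _, .axBot _ _ Γ Δ => .axBot c n Γ Δ
  | c, n+1, _, _, .impL _ _ Γ Δ A B a b => .impL c n Γ Δ A B a.trunc b.trunc
  | c, n+1, _, _, .impR _ _ Γ Δ A B a => .impR c n Γ Δ A B a.trunc
  | c, n+1, _, _, .box _ _ Γ Δ Θ l h a bs => .box c n Γ Δ Θ l h a.trunc (fun i => (bs i).trunc)
  | _, n+1, _, _, .cut _ Γ Δ A a b => .cut n Γ Δ A a.trunc b.trunc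

def Frag.height : ∀ {c : Bool} {n : ℕ} {Γ Δ : Multiset Formula}, Frag c n Γ Δ → ℕ
  | _, _, _, _, .hole _ _ _ => 0
  | _, _, _, _, .axP _ _ _ _ _ => 0
  | _, _, _, _, .axBot _ _ _ _ => 0
  | _, _, _, _, .impL _ _ _ _ _ _ a b => max a.height b.height + 1
  | _, _, _, _, .impR _ _ _ _ _ _ a => a.height + 1
  | _, _, _, _, .box _ _ _ _ _ _ _ a bs =>
      max a.height (Finset.univ.sup fun i => (bs i).height) + 1
  | _, _, _, _, .cut _ _ _ _ a b => max a.height b.height + 1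

def Frag.cutFree : ∀ {c : Bool} {n : ℕ} {Γ Δ : Multiset Formula}, Frag c n Γ Δ → Prop
  | _, _, _, _, .hole _ _ _ => True
  | _, _, _, _, .axP _ _ _ _ _ => True
  | _, _, _, _, .axBot _ _ _ _ => True
  | _, _, _, _, .impL _ _ _ _ _ _ a b => a.cutFree ∧ b.cutFree
  | _, _, _, _, .impR _ _ _ _ _ _ a => a.cutFree
  | _, _, _, _, .box _ _ _ _ _ _ _ a bs => a.cutFree ∧ ∀ i, (bs i).cutFree
  | _, _, _, _, .cut _ _ _ _ _ _ => False

structure InfProof (c : Bool) (Γ Δ : Multiset Formula) : Type where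
  frag : ∀ n : ℕ, Frag c n Γ Δ
  compat : ∀ n : ℕ, (frag (n+1)).trunc = frag n

structure PP : Type where
  Γ : Multiset Formula
  Δ : Multiset Formula
  prf : InfProof true Γ Δ

def Sim : ℕ → PP → PP → Prop
  | 0, _, _ => True
  | n+1, π, τ => π.Γ = τ.Γ ∧ π.Δ = τ.Δ ∧ HEq (π.prf.frag (n+1)) (τ.prf.frag (n+1))

noncomputable def dP (π τ : PP) : ℝ :=
  sInf {r : ℝ | ∃ n : ℕ, Sim n π τ ∧ r = (1/2 : ℝ) ^ n}

def localHeight (π : PP) : ℕ := (π.prf.frag 1).height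

def Pmem (n : ℕ) (π : PP) : Prop := (π.prf.frag n).cutFree

def starSet (Λ : Finset Formula) : Multiset Formula :=
  Λ.val.map (fun A => A.imp (Formula.box A))

/-- The formula `A → □A`. -/
def Formula.star (A : Formula) : Formula := A.imp A.box

/-- The set `{A} ∪ {subformulas of A}`. -/
def Formula.subformulas : Formula → Finset Formula
  | .atom p => {.atom p}
  | .bot => {.bot}
  | .imp A B => insert (A.imp B) (A.subformulas ∪ B.subformulas)
  | .box A => insert A.box A.subformulas

/-- Closure of a finite set of formulas under immediate subformulas. -/
structure SubClosed (S : Finset Formula) : Prop where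
  imp_left : ∀ {A B : Formula}, A.imp B ∈ S → A ∈ S
  imp_right : ∀ {A B : Formula}, A.imp B ∈ S → B ∈ S
  box : ∀ {A : Formula}, A.box ∈ S → A ∈ S

theorem Formula.mem_subformulas_self (A : Formula) : A ∈ A.subformulas := by
  cases A <;> simp [Formula.subformulas]

theorem Formula.subClosed_subformulas (A : Formula) : SubClosed A.subformulas := by
  induction A with
  | atom p => constructor <;> simp [Formula.subformulas]
  | bot => constructor <;> simp [Formula.subformulas]
  | imp A B ihA ihB =>
    have hA := A.mem_subformulas_self
    have hB := B.mem_subformulas_self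
    obtain ⟨a1, a2, a3⟩ := ihA
    obtain ⟨b1, b2, b3⟩ := ihB
    constructor <;> simp only [Formula.subformulas, Finset.mem_insert, Finset.mem_union] <;> grind
  | box A ih =>
    have hA := A.mem_subformulas_self
    obtain ⟨a1, a2, a3⟩ := ih
    constructor <;> simp only [Formula.subformulas, Finset.mem_insert] <;> grind

theorem SubClosed.biUnion (T : Finset Formula) (f : Formula → Finset Formula)
    (h : ∀ A, SubClosed (f A)) : SubClosed (T.biUnion f) := by
  constructor <;> intros <;> simp only [Finset.mem_biUnion] at * <;>
    obtain ⟨C, hC, hm⟩ := ‹∃ _, _›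
  · exact ⟨C, hC, (h C).imp_left hm⟩
  · exact ⟨C, hC, (h C).imp_right hm⟩
  · exact ⟨C, hC, (h C).box hm⟩

/-- A variant of cut-free `GoSeq` on sets of formulas, in which principal formulas are kept. -/
inductive SetSeq : Set Formula → Set Formula → Prop
  | ax {X Y : Set Formula} {A : Formula} : A ∈ X → A ∈ Y → SetSeq X Y
  | axBot {X Y : Set Formula} : Formula.bot ∈ X → SetSeq X Y
  | impL {X Y : Set Formula} {A B : Formula} : A.imp B ∈ X →
      SetSeq (insert B X) Y → SetSeq X (insert A Y) → SetSeq X Y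
  | impR {X Y : Set Formula} {A B : Formula} : A.imp B ∈ Y →
      SetSeq (insert A X) (insert B Y) → SetSeq X Y
  | boxGo {X Y : Set Formula} {A : Formula} (Θ : Finset Formula) : A.box ∈ Y →
      (∀ B ∈ Θ, B.box ∈ X) →
      SetSeq (insert A.star.box {C | C ∈ boxtimes Θ.val}) {A} → SetSeq X Y

/-- `Absorbed Γ Δ true A` says that adding `A` to the antecedent of `Γ ⇒ Δ` is redundant, either
because `A` is already there or because it has already been decomposed there by invertible rules;
`Absorbed Γ Δ false A` says the same of the succedent. -/
def Absorbed (Γ Δ : Multiset Formula) : Bool → Formula → Prop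
  | true, .imp A B => A.imp B ∈ Γ ∨ Absorbed Γ Δ true B ∨ Absorbed Γ Δ false A
  | false, .imp A B => A.imp B ∈ Δ ∨ (Absorbed Γ Δ true A ∧ Absorbed Γ Δ false B)
  | true, A => A ∈ Γ
  | false, A => A ∈ Δ

theorem Absorbed.of_mem_left {Γ Δ : Multiset Formula} {A : Formula} (h : A ∈ Γ) :
    Absorbed Γ Δ true A := by
  cases A <;> simp [Absorbed, h]

theorem Absorbed.of_mem_right {Γ Δ : Multiset Formula} {A : Formula} (h : A ∈ Δ) :
    Absorbed Γ Δ false A := by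
  cases A <;> simp [Absorbed, h]

theorem Absorbed.trans {Γ Δ Γ' Δ' : Multiset Formula}
    (hΓ : ∀ A ∈ Γ, Absorbed Γ' Δ' true A) (hΔ : ∀ A ∈ Δ, Absorbed Γ' Δ' false A)
    (b : Bool) (A : Formula) (h : Absorbed Γ Δ b A) : Absorbed Γ' Δ' b A := by
  induction A generalizing b with
  | imp A B ihA ihB =>
    cases b
    · rcases h with h | ⟨h₁, h₂⟩
      · exact hΔ _ h
      · exact Or.inr ⟨ihA _ h₁, ihB _ h₂⟩
    · rcases h with h | h | h
      · exact hΓ _ h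
      · exact Or.inr (Or.inl (ihB _ h))
      · exact Or.inr (Or.inr (ihA _ h))
  | _ => cases b <;> [exact hΔ _ h; exact hΓ _ h]

theorem Absorbed.impL_left {Γ Δ : Multiset Formula} (A B : Formula) (b : Bool) (C : Formula)
    (h : Absorbed (A.imp B ::ₘ Γ) Δ b C) : Absorbed (B ::ₘ Γ) Δ b C := by
  refine Absorbed.trans (fun D hD => ?_) (fun D hD => .of_mem_right hD) b C h
  rcases Multiset.mem_cons.1 hD with rfl | hD
  · exact Or.inr (Or.inl (.of_mem_left (Multiset.mem_cons_self _ _)))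
  · exact .of_mem_left (Multiset.mem_cons_of_mem hD)

theorem Absorbed.impL_right {Γ Δ : Multiset Formula} (A B : Formula) (b : Bool) (C : Formula)
    (h : Absorbed (A.imp B ::ₘ Γ) Δ b C) : Absorbed Γ (A ::ₘ Δ) b C := by
  refine Absorbed.trans (fun D hD => ?_)
    (fun D hD => .of_mem_right (Multiset.mem_cons_of_mem hD)) b C h
  rcases Multiset.mem_cons.1 hD with rfl | hD
  · exact Or.inr (Or.inr (.of_mem_right (Multiset.mem_cons_self _ _)))
  · exact .of_mem_left hD

theorem Absorbed.impR {Γ Δ : Multiset Formula} (A B : Formula) (b : Bool) (C : Formula)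
    (h : Absorbed Γ (A.imp B ::ₘ Δ) b C) : Absorbed (A ::ₘ Γ) (B ::ₘ Δ) b C := by
  refine Absorbed.trans (fun D hD => .of_mem_left (Multiset.mem_cons_of_mem hD))
    (fun D hD => ?_) b C h
  rcases Multiset.mem_cons.1 hD with rfl | hD
  · exact Or.inr ⟨.of_mem_left (Multiset.mem_cons_self _ _),
      .of_mem_right (Multiset.mem_cons_self _ _)⟩
  · exact .of_mem_right (Multiset.mem_cons_of_mem hD)

theorem GoSeq.ax_of_mem {Γ Δ : Multiset Formula} {A : Formula} (hΓ : A ∈ Γ) (hΔ : A ∈ Δ) :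
    GoSeq false Γ Δ := by
  obtain ⟨Γ, rfl⟩ := Multiset.exists_cons_of_mem hΓ
  obtain ⟨Δ, rfl⟩ := Multiset.exists_cons_of_mem hΔ
  exact .ax _ _ _ _

theorem GoSeq.of_absorbed (A : Formula) {Γ Δ : Multiset Formula} (hΓ : Absorbed Γ Δ true A)
    (hΔ : Absorbed Γ Δ false A) : GoSeq false Γ Δ := by
  induction A generalizing Γ Δ with
  | imp A B ihA ihB =>
    rcases hΔ with hΔ | ⟨hA, hB⟩
    · rcases hΓ with hΓ | hΓ
      · exact GoSeq.ax_of_mem hΓ hΔ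
      · obtain ⟨Δ, rfl⟩ := Multiset.exists_cons_of_mem hΔ
        refine .impR _ _ _ _ _ ?_
        rcases hΓ with hΓ | hΓ
        · exact ihB (hΓ.impR) (.of_mem_right (Multiset.mem_cons_self _ _))
        · exact ihA (.of_mem_left (Multiset.mem_cons_self _ _)) (hΓ.impR)
    · rcases hΓ with hΓ | hΓ | hΓ
      · obtain ⟨Γ, rfl⟩ := Multiset.exists_cons_of_mem hΓ
        exact .impL _ _ _ _ _
          (ihB (.of_mem_left (Multiset.mem_cons_self _ _)) (hB.impL_left))
          (ihA (hA.impL_right) (.of_mem_right (Multiset.mem_cons_self _ _)))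
      · exact ihB hΓ hB
      · exact ihA hA hΓ
  | _ => exact GoSeq.ax_of_mem hΓ hΔ

theorem Formula.box_injective : Function.Injective Formula.box := fun _ _ h => Formula.box.inj h

theorem SetSeq.goSeq_of_absorbed {X Y : Set Formula} (h : SetSeq X Y) {Γ Δ : Multiset Formula}
    (hX : ∀ A ∈ X, Absorbed Γ Δ true A) (hY : ∀ A ∈ Y, Absorbed Γ Δ false A) :
    GoSeq false Γ Δ := by
  induction h generalizing Γ Δ with
  | ax h₁ h₂ => exact GoSeq.of_absorbed _ (hX _ h₁) (hY _ h₂)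
  | axBot h =>
    obtain ⟨Γ, rfl⟩ := Multiset.exists_cons_of_mem (show Formula.bot ∈ Γ from hX _ h)
    exact .axBot _ _ _
  | impL h _ _ ih₁ ih₂ =>
    rcases hX _ h with h | h | h
    · obtain ⟨Γ, rfl⟩ := Multiset.exists_cons_of_mem h
      refine .impL _ _ _ _ _ (ih₁ ?_ fun A hA => (hY A hA).impL_left)
        (ih₂ (fun A hA => (hX A hA).impL_right) ?_)
      · exact Set.forall_mem_insert.2
          ⟨.of_mem_left (Multiset.mem_cons_self _ _), fun A hA => (hX A hA).impL_left⟩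
      · exact Set.forall_mem_insert.2
          ⟨.of_mem_right (Multiset.mem_cons_self _ _), fun A hA => (hY A hA).impL_right⟩
    · exact ih₁ (Set.forall_mem_insert.2 ⟨h, hX⟩) hY
    · exact ih₂ hX (Set.forall_mem_insert.2 ⟨h, hY⟩)
  | impR h _ ih =>
    rcases hY _ h with h | ⟨h₁, h₂⟩
    · obtain ⟨Δ, rfl⟩ := Multiset.exists_cons_of_mem h
      refine .impR _ _ _ _ _ (ih ?_ ?_)
      · exact Set.forall_mem_insert.2
          ⟨.of_mem_left (Multiset.mem_cons_self _ _), fun A hA => (hX A hA).impR⟩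
      · exact Set.forall_mem_insert.2
          ⟨.of_mem_right (Multiset.mem_cons_self _ _), fun A hA => (hY A hA).impR⟩
    · exact ih (Set.forall_mem_insert.2 ⟨h₁, hX⟩) (Set.forall_mem_insert.2 ⟨h₂, hY⟩)
  | @boxGo X Y A Θ h hΘ _ ih =>
    obtain ⟨Δ, rfl⟩ := Multiset.exists_cons_of_mem (show A.box ∈ Δ from hY _ h)
    have hle : Θ.val.map Formula.box ≤ Γ := by
      refine (Multiset.le_iff_subset (Θ.nodup.map Formula.box_injective)).2 fun C hC => ?_
      obtain ⟨B, hB, rfl⟩ := Multiset.mem_map.1 hC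
      exact hX _ (hΘ B hB)
    obtain ⟨Γ, rfl⟩ := Multiset.le_iff_exists_add.1 hle
    rw [add_comm]
    refine .boxGo _ _ _ _ _ (ih ?_ ?_)
    · exact Set.forall_mem_insert.2 ⟨.of_mem_left (Multiset.mem_cons_self _ _),
        fun B hB => .of_mem_left (Multiset.mem_cons_of_mem hB)⟩
    · rintro B rfl
      exact .of_mem_right (Multiset.mem_singleton_self _)

theorem SetSeq.of_star_mem {X : Set Formula} (l : List Formula) {Y : Set Formula}
    (hX : ∀ A ∈ l, A.star ∈ X) (hY : ∀ A ∈ l, A.box ∈ Y)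
    (h : SetSeq X (Y ∪ {A | A ∈ l})) : SetSeq X Y := by
  induction l generalizing Y with
  | nil => simpa using h
  | cons A l ih =>
    simp only [List.forall_mem_cons] at hX hY
    refine .impL hX.1 (.ax (Set.mem_insert _ _) hY.1) (ih hX.2 (fun B hB => Or.inr (hY.2 B hB)) ?_)
    convert h using 1
    ext B
    simp only [Set.mem_union, Set.mem_insert_iff, Set.mem_ofPred_eq, List.mem_cons]
    tauto

theorem mem_boxtimes {Γ : Multiset Formula} {C : Formula} :
    C ∈ boxtimes Γ ↔ C ∈ Γ ∨ ∃ A ∈ Γ, A.box = C := by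
  simp [boxtimes]

theorem Finset.card_sdiff_add_lt {α : Type*} [DecidableEq α] {S L₁ L₂ O L₁' L₂' O' : Finset α}
    (h₁ : L₁ ⊆ L₁') (h₂ : L₂ ⊆ L₂') (hO : O ⊆ O')
    (h : ∃ a ∈ S, (a ∉ L₁ ∧ a ∈ L₁') ∨ (a ∉ L₂ ∧ a ∈ L₂') ∨ (a ∉ O ∧ a ∈ O')) :
    (S \ L₁').card + (S \ L₂').card + (S \ O').card <
      (S \ L₁).card + (S \ L₂).card + (S \ O).card := by
  have le {L L' : Finset α} (h : L ⊆ L') : (S \ L').card ≤ (S \ L).card :=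
    Finset.card_le_card (Finset.sdiff_subset_sdiff le_rfl h)
  have lt {L L' : Finset α} (h : L ⊆ L') {a : α} (ha : a ∈ S) (hL : a ∉ L ∧ a ∈ L') :
      (S \ L').card < (S \ L).card := by
    refine Finset.card_lt_card ⟨Finset.sdiff_subset_sdiff le_rfl h, fun hs => ?_⟩
    exact (Finset.mem_sdiff.1 (hs (Finset.mem_sdiff.2 ⟨ha, hL.1⟩))).2 hL.2
  have l₁ := le h₁
  have l₂ := le h₂
  have l₃ := le hO
  obtain ⟨a, ha, h | h | h⟩ := h
  · have := lt h₁ ha h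
    omega
  · have := lt h₂ ha h
    omega
  · have := lt hO ha h
    omega

theorem Frag.setSeq {c : Bool} {n : ℕ} {Γ Δ : Multiset Formula} (π : Frag c n Γ Δ)
    (hc : c = false) {S : Finset Formula} (hS : SubClosed S)
    (hΓ : ∀ A ∈ Γ, A ∈ S) (hΔ : ∀ A ∈ Δ, A ∈ S) {Λ₁ Λ₂ Ω : Finset Formula} (hsub : Λ₂ ⊆ Λ₁)
    (hn : (S \ Λ₁).card + (S \ Λ₂).card + (S \ Ω).card < n) {X Y : Set Formula}
    (h₁ : ∀ A ∈ Λ₁, A.star.box ∈ X) (h₂ : ∀ A ∈ Λ₂, A.star ∈ X)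
    (hΩ : ∀ A ∈ Ω, A ∈ X ∧ A.box ∈ X) (hX : ∀ A ∈ Γ, A ∈ X) (hY : ∀ A ∈ Δ, A ∈ Y) :
    SetSeq X Y := by
  induction π generalizing Λ₁ Λ₂ Ω X Y with
  | hole => omega
  | axP => exact .ax (hX _ (Multiset.mem_cons_self _ _)) (hY _ (Multiset.mem_cons_self _ _))
  | axBot => exact .axBot (hX _ (Multiset.mem_cons_self _ _))
  | impL c n Γ Δ A B π₁ π₂ ih₁ ih₂ =>
    simp only [Multiset.mem_cons, forall_eq_or_imp] at hΓ hX ih₁ ih₂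
    refine .impL hX.1 (ih₁ hc ⟨hS.imp_right hΓ.1, hΓ.2⟩ hΔ hsub hn ?_ ?_ ?_ ?_ hY)
      (ih₂ hc hΓ.2 ⟨hS.imp_left hΓ.1, hΔ⟩ hsub hn h₁ h₂ hΩ hX.2 ?_) <;> grind
  | impR c n Γ Δ A B π ih =>
    simp only [Multiset.mem_cons, forall_eq_or_imp] at hΔ hY ih
    refine .impR hY.1 (ih hc ⟨hS.imp_left hΔ.1, hΓ⟩ ⟨hS.imp_right hΔ.1, hΔ.2⟩ hsub hn
      ?_ ?_ ?_ ?_ ?_) <;> grind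
  | cut => simp at hc
  | box c n Γ Δ Θ l hl π₀ π ih₀ ih =>
    have hΘX : ∀ A ∈ Θ, A.box ∈ X := fun A hA =>
      hX _ (Multiset.mem_add.2 (Or.inr (Multiset.mem_map_of_mem _ hA)))
    have hΘS : ∀ A ∈ Θ, A.box ∈ S := fun A hA =>
      hΓ _ (Multiset.mem_add.2 (Or.inr (Multiset.mem_map_of_mem _ hA)))
    have hlmem : ∀ A ∈ l, A.box ∈ (↑(l.map Formula.box) : Multiset Formula) + Δ := fun A hA =>
      Multiset.mem_add.2 (Or.inl (Multiset.mem_coe.2 (List.mem_map_of_mem hA)))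
    have hlY : ∀ A ∈ l, A.box ∈ Y := fun A hA => hY _ (hlmem A hA)
    have hlS : ∀ A ∈ l, A.box ∈ S := fun A hA => hΔ _ (hlmem A hA)
    have hΘS' : ∀ A ∈ boxtimes Θ, A ∈ S := by
      intro A hA
      rcases mem_boxtimes.1 hA with hA | ⟨B, hB, rfl⟩
      exacts [hS.box (hΘS A hA), hΘS B hB]
    by_cases hdone : (∀ A ∈ l, A ∈ Λ₂) ∧ ∀ A ∈ Θ, A ∈ Ω
    · refine SetSeq.of_star_mem l (fun A hA => h₂ A (hdone.1 A hA)) hlY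
        (ih₀ hc hΘS' ?_ hsub hn h₁ h₂ hΩ ?_ ?_)
      · intro A hA
        rcases mem_boxtimes.1 hA with hA | ⟨B, hB, rfl⟩
        exacts [hS.box (hlS A hA), hlS B hB]
      · intro A hA
        rcases mem_boxtimes.1 hA with hA | ⟨B, hB, rfl⟩
        exacts [(hΩ A (hdone.2 A hA)).1, hΘX B hB]
      · intro A hA
        rcases mem_boxtimes.1 hA with hA | ⟨B, hB, rfl⟩
        exacts [Or.inr hA, Or.inl (hlY B hB)]
    · obtain ⟨i, hi⟩ : ∃ i : Fin l.length, l.get i ∉ Λ₂ ∨ ∃ A ∈ Θ, A ∉ Ω := by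
        rw [not_and_or] at hdone
        push Not at hdone
        rcases hdone with ⟨A, hA, hA'⟩ | h
        · obtain ⟨i, rfl⟩ := List.get_of_mem hA
          exact ⟨i, Or.inl hA'⟩
        · exact ⟨⟨0, List.length_pos_iff.2 hl⟩, Or.inr h⟩
      have hil : l.get i ∈ l := List.get_mem l i
      have hlt : (S \ insert (l.get i) Λ₁).card + (S \ Λ₁).card + (S \ (Ω ∪ Θ.toFinset)).card <
          (S \ Λ₁).card + (S \ Λ₂).card + (S \ Ω).card := by
        refine Finset.card_sdiff_add_lt (Finset.subset_insert _ _) hsub Finset.subset_union_left ?_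
        rcases hi with hi | ⟨A, hA, hA'⟩
        · refine ⟨_, hS.box (hlS _ hil), ?_⟩
          by_cases hi' : l.get i ∈ Λ₁
          · exact Or.inr (Or.inl ⟨hi, hi'⟩)
          · exact Or.inl ⟨hi', Finset.mem_insert_self _ _⟩
        · exact ⟨A, hS.box (hΘS A hA), Or.inr (Or.inr ⟨hA', by simp [hA]⟩)⟩
      refine .boxGo (A := l.get i) (Λ₁.image Formula.star ∪ (Ω ∪ Θ.toFinset)) (hlY _ hil) ?_
        (ih i hc hΘS' ?_ (Finset.subset_insert (l.get i) Λ₁)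
          (Ω := Ω ∪ Θ.toFinset) (by omega) ?_ ?_ ?_ ?_ ?_)
      · intro B hB
        simp only [Finset.mem_union, Finset.mem_image, Multiset.mem_toFinset] at hB
        rcases hB with ⟨A, hA, rfl⟩ | hB | hB
        exacts [h₁ A hA, (hΩ B hB).2, hΘX B hB]
      · intro A hA
        rw [Multiset.mem_singleton.1 hA]
        exact hS.box (hlS _ hil)
      · intro A hA
        rcases Finset.mem_insert.1 hA with rfl | hA
        · exact Set.mem_insert _ _
        · exact Or.inr (mem_boxtimes.2 (Or.inr ⟨A.star,
            Finset.mem_union_left _ (Finset.mem_image_of_mem _ hA), rfl⟩))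
      · exact fun A hA => Or.inr (mem_boxtimes.2 (Or.inl
          (Finset.mem_union_left _ (Finset.mem_image_of_mem _ hA))))
      · exact fun A hA => ⟨Or.inr (mem_boxtimes.2 (Or.inl (Finset.mem_union_right _ hA))),
          Or.inr (mem_boxtimes.2 (Or.inr ⟨A, Finset.mem_union_right _ hA, rfl⟩))⟩
      · intro A hA
        have hmem : ∀ B ∈ Θ, B ∈ (Λ₁.image Formula.star ∪ (Ω ∪ Θ.toFinset)).val := fun B hB =>
          Finset.mem_union_right _ (Finset.mem_union_right _ (Multiset.mem_toFinset.2 hB))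
        refine Or.inr (mem_boxtimes.2 ?_)
        rcases mem_boxtimes.1 hA with hA | ⟨B, hB, rfl⟩
        exacts [Or.inl (hmem A hA), Or.inr ⟨B, hmem B hB, rfl⟩]
      · exact fun A hA => Multiset.mem_singleton.1 hA

theorem stmt7 (Γ Δ : Multiset Formula) (h : Nonempty (InfProof false Γ Δ))
    (Λ₁ Λ₂ Ω : Finset Formula) (hsub : Λ₂ ⊆ Λ₁) :
    GoSeq false ((starSet Λ₁).map Formula.box + starSet Λ₂ + boxtimes Ω.val + Γ) Δ := by
  obtain ⟨π⟩ := h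
  let S : Finset Formula := (Γ + Δ).toFinset.biUnion Formula.subformulas
  have hmem : ∀ A ∈ Γ + Δ, A ∈ S := fun A hA =>
    Finset.mem_biUnion.2 ⟨A, Multiset.mem_toFinset.2 hA, A.mem_subformulas_self⟩
  have hseq := (π.frag ((S \ Λ₁).card + (S \ Λ₂).card + (S \ Ω).card + 1)).setSeq rfl
    (SubClosed.biUnion _ _ Formula.subClosed_subformulas)
    (fun A hA => hmem A (Multiset.mem_add.2 (Or.inl hA)))
    (fun A hA => hmem A (Multiset.mem_add.2 (Or.inr hA))) hsub (Nat.lt_succ_self _)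
    (X := {A | A ∈ (starSet Λ₁).map Formula.box + starSet Λ₂ + boxtimes Ω.val + Γ})
    (Y := {A | A ∈ Δ})
  refine SetSeq.goSeq_of_absorbed (hseq ?_ ?_ ?_ ?_ fun A hA => hA)
    (fun A hA => .of_mem_left hA) fun A hA => .of_mem_right hA
  · intro A hA
    have : A.star ∈ starSet Λ₁ := Multiset.mem_map_of_mem _ hA
    simp only [Set.mem_ofPred_eq, Multiset.mem_add]
    exact Or.inl (Or.inl (Or.inl (Multiset.mem_map_of_mem _ this)))
  · intro A hA
    have : A.star ∈ starSet Λ₂ := Multiset.mem_map_of_mem _ hA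
    simp only [Set.mem_ofPred_eq, Multiset.mem_add]
    exact Or.inl (Or.inl (Or.inr this))
  · intro A hA
    simp only [Set.mem_ofPred_eq, Multiset.mem_add, mem_boxtimes]
    exact ⟨Or.inl (Or.inr (Or.inl hA)), Or.inl (Or.inr (Or.inr ⟨A, hA, rfl⟩))⟩
  · intro A hA
    simp only [Set.mem_ofPred_eq, Multiset.mem_add]
    exact Or.inr hA
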